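/- Let −1 < a1 < 0, δ > 0 and a2 ≤ a1/3. If γ is a periodic solution of system (III) whose first component satisfies |(γ t).1| < √(−a1) for all t ∈ ℝ, then γ is constant. (System (III) has no small limit cycles surrounding the origin when a2 ≤ a1/3.) -/

import Mathlib

/-- A solution of system (III): x' = y − δ(a2 x + x³/3), y' = −x(a1 + x²)(x² − 1). -/
def IsSolIII (a1 a2 δ : ℝ) (γ : ℝ → ℝ × ℝ) : Prop :=
  ∀ t : ℝ, HasDerivAt γ
    ((γ t).2 - δ * (a2 * (γ t).1 + (γ t).1 ^ 3 / 3),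
      -((γ t).1 * (a1 + (γ t).1 ^ 2) * ((γ t).1 ^ 2 - 1))) t

/-- A differentiable periodic real function with nonnegative derivative has zero derivative. -/
theorem deriv_eq_zero_of_periodic_of_nonneg {f f' : ℝ → ℝ} {T : ℝ} (hT : 0 < T)
    (hf : ∀ t, HasDerivAt f (f' t) t) (hper : Function.Periodic f T) (hnn : ∀ t, 0 ≤ f' t)
    (t : ℝ) : f' t = 0 := by
  have hmono : Monotone f := monotone_of_hasDerivAt_nonneg hf hnn
  have hconst : f =ᶠ[nhds t] fun _ => f t := by
    filter_upwards [Ioo_mem_nhds (show t - T < t by linarith) (show t < t + T by linarith)]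
      with s hs
    apply le_antisymm
    · exact (hmono hs.2.le).trans (hper t).le
    · exact (hper.sub_eq t).ge.trans (hmono hs.1.le)
  exact (hf t).unique ((hasDerivAt_const t (f t)).congr_of_eventuallyEq hconst)

/-- for −1 < a1 < 0, δ > 0, a2 ≤ a1/3, every periodic solution of
system (III) lying in the strip |x| < √(−a1) is constant (no small limit cycles
around the origin). -/
theorem stmt10 (a1 a2 δ : ℝ) (ha1l : -1 < a1) (ha1r : a1 < 0) (hδ : 0 < δ)
    (ha2 : a2 ≤ a1 / 3)
    (γ : ℝ → ℝ × ℝ) (hsol : IsSolIII a1 a2 δ γ)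
    (T : ℝ) (hT : 0 < T) (hper : ∀ t : ℝ, γ (t + T) = γ t)
    (hstrip : ∀ t : ℝ, |(γ t).1| < Real.sqrt (-a1)) :
    ∀ t s : ℝ, γ t = γ s := by
  have hx : ∀ t, HasDerivAt (fun t => (γ t).1)
      ((γ t).2 - δ * (a2 * (γ t).1 + (γ t).1 ^ 3 / 3)) t := fun t => (hsol t).fst
  have hy : ∀ t, HasDerivAt (fun t => (γ t).2)
      (-((γ t).1 * (a1 + (γ t).1 ^ 2) * ((γ t).1 ^ 2 - 1))) t := fun t => (hsol t).snd
  have hsq : ∀ t, (γ t).1 ^ 2 < -a1 := fun t => by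
    rw [← sq_abs]
    exact (Real.lt_sqrt (abs_nonneg _)).1 (hstrip t)
  have hpos : ∀ t, 0 < δ * (-(a2 + (γ t).1 ^ 2 / 3)) *
      (-(a1 + (γ t).1 ^ 2) * (1 - (γ t).1 ^ 2)) := fun t => by
    have h := hsq t
    exact mul_pos (mul_pos hδ (by linarith)) (mul_pos (by linarith) (by linarith))
  have hE : ∀ t, HasDerivAt
      (fun t => (γ t).2 ^ 2 / 2 + ((γ t).1 ^ 6 / 6 + (a1 - 1) * (γ t).1 ^ 4 / 4
        - a1 * (γ t).1 ^ 2 / 2))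
      ((γ t).1 ^ 2 * (δ * (-(a2 + (γ t).1 ^ 2 / 3)) *
        (-(a1 + (γ t).1 ^ 2) * (1 - (γ t).1 ^ 2)))) t := fun t => by
    refine ((((hy t).pow 2).div_const 2).add (((((hx t).pow 6).div_const 6).add
      ((((hx t).pow 4).const_mul (a1 - 1)).div_const 4)).sub
      ((((hx t).pow 2).const_mul a1).div_const 2))).congr_deriv ?_
    push_cast
    ring
  have hx0 : ∀ t, (γ t).1 = 0 := fun t => by
    have h := deriv_eq_zero_of_periodic_of_nonneg hT hE (fun t => by simp only [hper])
      (fun t => mul_nonneg (sq_nonneg _) (hpos t).le) t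
    exact pow_eq_zero_iff two_ne_zero |>.1 ((mul_eq_zero.1 h).resolve_right (hpos t).ne')
  have hy0 : ∀ t, (γ t).2 = 0 := fun t => by
    have h := hx t
    simp only [hx0] at h
    simpa using h.unique (hasDerivAt_const t 0)
  exact fun t s => Prod.ext ((hx0 t).trans (hx0 s).symm) ((hy0 t).trans (hy0 s).symm)
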